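/- Let $n \ge 1$, let $\hat\phi \in \mathbb{R}^{n \times n}$, and let $\theta^* \in \mathbb{R}^n$ satisfy $\sum_{i=1}^n \theta^*_i = 0$. Define $\phi^* \in \mathbb{R}^{n \times n}$ by $\phi^*_{ij} = \theta^*_j - \theta^*_i$. If $\hat\theta \in \mathbb{R}^n$ with $\sum_i \hat\theta_i = 0$ minimizes $\sum_{i,j} (\theta_j - \theta_i - \hat\phi_{ij})^2$ over all $\theta \in \mathbb{R}^n$ with $\sum_i \theta_i = 0$, then $\lVert \hat\theta - \theta^* \rVert_2 \le \lVert \hat\phi - \phi^* \rVert_F / \sqrt{2n}$, where $\lVert \cdot \rVert_F$ denotes the Frobenius norm. -/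

import Mathlib

open Finset

/-- The square of the Frobenius norm of the difference matrix of a zero-sum vector. -/
theorem sum_sum_sub_sq_of_sum_eq_zero {ι : Type*} [Fintype ι] (d : ι → ℝ)
    (hd : ∑ i, d i = 0) :
    ∑ i, ∑ j, (d j - d i) ^ 2 = 2 * Fintype.card ι * ∑ i, d i ^ 2 := by
  have hcross : ∑ i, ∑ j, 2 * d j * d i = 0 := by
    simp_rw [← Finset.sum_mul, ← Finset.mul_sum, hd]
    simp
  simp_rw [sub_sq, Finset.sum_add_distrib, Finset.sum_sub_distrib, hcross]
  simp only [Finset.sum_const, Finset.card_univ, nsmul_eq_mul, ← Finset.mul_sum]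
  ring

/-- If the residual `r` cannot be shortened by moving along the line spanned by `δ`, then
`r` is orthogonal to `δ`, so `δ` is no longer than `r + δ`. -/
theorem sum_sq_le_sum_add_sq_of_forall_le {κ : Type*} [Fintype κ] (r δ : κ → ℝ)
    (h : ∀ t : ℝ, ∑ k, r k ^ 2 ≤ ∑ k, (r k + t * δ k) ^ 2) :
    ∑ k, δ k ^ 2 ≤ ∑ k, (r k + δ k) ^ 2 := by
  have expand (t : ℝ) : ∑ k, (r k + t * δ k) ^ 2 =
      ∑ k, r k ^ 2 + 2 * t * ∑ k, r k * δ k + t ^ 2 * ∑ k, δ k ^ 2 := by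
    simp_rw [Finset.mul_sum, ← Finset.sum_add_distrib]
    exact Finset.sum_congr rfl fun k _ => by ring
  have horth : ∑ k, r k * δ k = 0 := by
    have hdisc := discrim_le_zero (a := ∑ k, δ k ^ 2) (b := 2 * ∑ k, r k * δ k) (c := 0)
      fun t => by linarith [h t, expand t]
    rw [discrim] at hdisc
    nlinarith
  have hr : 0 ≤ ∑ k, r k ^ 2 := Finset.sum_nonneg fun k _ => sq_nonneg _
  have h1 := expand 1
  simp only [one_mul, horth] at h1
  linarith

/-- least squares guarantee. If the zero-sum vector `θ̂` minimizes the
Frobenius distance of its difference matrix to `φ̂` over zero-sum vectors, then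
`‖θ̂ - θ*‖₂ ≤ ‖φ̂ - φ*‖_F / √(2n)` where `φ*ᵢⱼ = θ*ⱼ - θ*ᵢ`. -/
theorem least_squares_guarantee
    (n : ℕ) (hn : 1 ≤ n) (φhat : Fin n → Fin n → ℝ)
    (θstar : Fin n → ℝ) (hstar : ∑ i : Fin n, θstar i = 0)
    (θhat : Fin n → ℝ) (hhat : ∑ i : Fin n, θhat i = 0)
    (hmin : ∀ θ : Fin n → ℝ, (∑ i : Fin n, θ i) = 0 →
      ∑ i : Fin n, ∑ j : Fin n, (θhat j - θhat i - φhat i j) ^ 2 ≤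
        ∑ i : Fin n, ∑ j : Fin n, (θ j - θ i - φhat i j) ^ 2) :
    Real.sqrt (∑ i : Fin n, (θhat i - θstar i) ^ 2) ≤
      Real.sqrt (∑ i : Fin n, ∑ j : Fin n, (φhat i j - (θstar j - θstar i)) ^ 2) /
        Real.sqrt (2 * n) := by
  have hn' : (0 : ℝ) < 2 * n := by
    have : (0 : ℝ) < n := by exact_mod_cast hn
    linarith
  have hd : ∑ i, (θstar i - θhat i) = 0 := by
    rw [Finset.sum_sub_distrib, hstar, hhat, sub_zero]
  have hiso := sum_sum_sub_sq_of_sum_eq_zero _ hd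
  have hproj := sum_sq_le_sum_add_sq_of_forall_le
    (fun p : Fin n × Fin n => θhat p.2 - θhat p.1 - φhat p.1 p.2)
    (fun p => (θstar p.2 - θhat p.2) - (θstar p.1 - θhat p.1)) fun t => by
      have hline := hmin (fun i => θhat i + t * (θstar i - θhat i)) (by
        rw [Finset.sum_add_distrib, ← Finset.mul_sum, hd, hhat]
        ring)
      simp only [Fintype.sum_prod_type]
      refine hline.trans_eq ?_
      exact Finset.sum_congr rfl fun i _ => Finset.sum_congr rfl fun j _ => by ring
  simp only [Fintype.sum_prod_type] at hproj
  rw [hiso, Fintype.card_fin] at hproj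
  rw [← Real.sqrt_div' _ hn'.le]
  refine Real.sqrt_le_sqrt ?_
  rw [le_div_iff₀ hn', mul_comm]
  calc 2 * (n : ℝ) * ∑ i, (θhat i - θstar i) ^ 2
      = 2 * n * ∑ i, (θstar i - θhat i) ^ 2 := by simp_rw [sub_sq_comm]
    _ ≤ _ := hproj
    _ = _ := Finset.sum_congr rfl fun i _ => Finset.sum_congr rfl fun j _ => by ring
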